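/- Let X and Y be real-valued random variables on a common probability space, each square-integrable with positive variance and with continuous distribution functions F(·;X) and F(·;Y). Then the squared Pearson correlation is bounded by the LPINFOR dependence measure: R(X,Y)² ≤ ∑_{j≥1} ∑_{k≥1} |LP(j,k;X,Y)|², where LP(j,k;X,Y) = E[Leg_j(F(X;X))·Leg_k(F(Y;Y))] and the (possibly infinite) double sum is taken in [0, ∞]. -/

import Mathlib

open MeasureTheory Set

/-- The `j`-th orthonormal shifted Legendre polynomial on `[0,1]` (Rodrigues'
formula), the result of Gram–Schmidt orthonormalization of `1, u, u², …` in
`L²([0,1])`. In particular `Leg 0 = 1` and `Leg 1 u = √12 (u − 1/2)`. -/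
noncomputable def Leg (j : ℕ) (u : ℝ) : ℝ :=
  (Real.sqrt (2 * j + 1) / j.factorial) * iteratedDeriv j (fun x => (x ^ 2 - x) ^ j) u

/-- The distribution function `F(x;X) = P(X ≤ x)`. -/
noncomputable def distFun {Ω : Type*} [MeasurableSpace Ω] (P : Measure Ω)
    (X : Ω → ℝ) (x : ℝ) : ℝ :=
  (P (X ⁻¹' Iic x)).toReal

/-- The standardization `Z(X) = (X − E[X])/σ(X)`. -/
noncomputable def stdize {Ω : Type*} [MeasurableSpace Ω] (P : Measure Ω)
    (X : Ω → ℝ) (ω : Ω) : ℝ :=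
  (X ω - ∫ ω', X ω' ∂P) / Real.sqrt (ProbabilityTheory.variance X P)

/-- The LP comoment `LP(j,k;X,Y) = E[Leg_j(F(X;X))·Leg_k(F(Y;Y))]`. -/
noncomputable def LPcom {Ω : Type*} [MeasurableSpace Ω] (P : Measure Ω)
    (X Y : Ω → ℝ) (j k : ℕ) : ℝ :=
  ∫ ω, Leg j (distFun P X (X ω)) * Leg k (distFun P Y (Y ω)) ∂P

open Polynomial in
/-- The integral of a real polynomial over `[0, 1]`. -/
noncomputable def unitIntegral (p : ℝ[X]) : ℝ := ∫ x in (0 : ℝ)..1, p.eval x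

namespace Polynomial

theorem intervalIntegrable_eval (p : ℝ[X]) (a b : ℝ) :
    IntervalIntegrable (fun x => p.eval x) volume a b :=
  p.continuous.intervalIntegrable a b

theorem unitIntegral_add (p q : ℝ[X]) :
    unitIntegral (p + q) = unitIntegral p + unitIntegral q := by
  simp only [unitIntegral, eval_add]
  exact intervalIntegral.integral_add (p.intervalIntegrable_eval 0 1)
    (q.intervalIntegrable_eval 0 1)

theorem unitIntegral_C_mul (c : ℝ) (p : ℝ[X]) :
    unitIntegral (C c * p) = c * unitIntegral p := by
  simp [unitIntegral]

theorem unitIntegral_derivative (p : ℝ[X]) :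
    unitIntegral (derivative p) = p.eval 1 - p.eval 0 :=
  intervalIntegral.integral_eq_sub_of_hasDerivAt (fun x _ => p.hasDerivAt x)
    ((derivative p).intervalIntegrable_eval 0 1)

theorem unitIntegral_derivative_mul {p : ℝ[X]} (h0 : p.eval 0 = 0) (h1 : p.eval 1 = 0)
    (q : ℝ[X]) : unitIntegral (derivative p * q) = -unitIntegral (p * derivative q) := by
  have h := unitIntegral_derivative (p * q)
  rw [derivative_mul, unitIntegral_add] at h
  simp only [eval_mul, h0, h1] at h
  linarith

theorem eval_iterate_derivative_pow_eq_zero {p : ℝ[X]} {x : ℝ} (hx : p.eval x = 0)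
    {i n : ℕ} (hi : i < n) : (derivative^[i] (p ^ n)).eval x = 0 := by
  obtain ⟨r, hr⟩ := pow_sub_dvd_iterate_derivative_pow p n i
  rw [hr, eval_mul, eval_pow, hx, zero_pow (by omega), zero_mul]

theorem unitIntegral_iterate_derivative_mul (n : ℕ) {i : ℕ} (hi : i ≤ n) (q : ℝ[X]) :
    unitIntegral (derivative^[i] ((X ^ 2 - X) ^ n) * q) =
      (-1) ^ i * unitIntegral ((X ^ 2 - X) ^ n * derivative^[i] q) := by
  induction i generalizing q with
  | zero => simp
  | succ i ih =>
    rw [Function.iterate_succ_apply', unitIntegral_derivative_mul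
      (eval_iterate_derivative_pow_eq_zero (by simp) (by omega))
      (eval_iterate_derivative_pow_eq_zero (by simp) (by omega)), ih (by omega),
      Function.iterate_succ_apply]
    ring

theorem unitIntegral_X_pow_mul_one_sub_X_pow (a b : ℕ) :
    unitIntegral (X ^ a * (1 - X) ^ b) =
      (a.factorial * b.factorial : ℝ) / (a + b + 1).factorial := by
  induction b generalizing a with
  | zero =>
    simp [unitIntegral, Nat.factorial_succ]
    field_simp
  | succ b ih =>
    have h := unitIntegral_derivative_mul (p := X ^ (a + 1) * (1 - X) ^ (b + 1)) (by simp)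
      (by simp) 1
    have e : derivative ((X : ℝ[X]) ^ (a + 1) * (1 - X) ^ (b + 1)) * 1 =
        C (a + 1 : ℝ) * (X ^ a * (1 - X) ^ (b + 1)) +
          C (-(b + 1) : ℝ) * (X ^ (a + 1) * (1 - X) ^ b) := by
      simp [derivative_mul, derivative_pow]
      ring
    rw [e, unitIntegral_add, unitIntegral_C_mul, unitIntegral_C_mul, ih] at h
    simp [unitIntegral] at h
    have ha : ((a : ℝ) + 1) ≠ 0 := by positivity
    apply mul_left_cancel₀ ha
    have h_int : unitIntegral (X ^ a * (1 - X) ^ (b + 1)) =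
        ∫ x in (0 : ℝ)..1, x ^ a * (1 - x) ^ (b + 1) := by
      simp [unitIntegral]
    rw [h_int, eq_neg_of_add_eq_zero_left h, show a + (b + 1) + 1 = a + 1 + b + 1 by ring,
      Nat.factorial_succ a, Nat.factorial_succ b]
    push_cast
    ring

theorem natDegree_X_sq_sub_X_pow (n : ℕ) :
    ((X ^ 2 - X : ℝ[X]) ^ n).natDegree = 2 * n := by
  have : (X ^ 2 - X : ℝ[X]).natDegree = 2 := by compute_degree!
  rw [natDegree_pow, this, mul_comm]

theorem monic_X_sq_sub_X_pow (n : ℕ) : ((X ^ 2 - X : ℝ[X]) ^ n).Monic := by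
  apply Monic.pow
  monicity!

end Polynomial

open Polynomial in
/-- The polynomial underlying `Leg j`. -/
noncomputable def legPoly (j : ℕ) : ℝ[X] :=
  C (Real.sqrt (2 * j + 1) / j.factorial) * derivative^[j] ((X ^ 2 - X) ^ j)

namespace Polynomial

theorem Leg_eq_eval_legPoly (j : ℕ) (u : ℝ) : Leg j u = (legPoly j).eval u := by
  have h : ∀ (n : ℕ) (p : ℝ[X]), iteratedDeriv n (fun x => p.eval x) =
      fun x => (derivative^[n] p).eval x := by
    intro n
    induction n with
    | zero => simp
    | succ n ih =>
      intro p
      rw [iteratedDeriv_succ, ih, Function.iterate_succ_apply']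
      ext x
      exact Polynomial.deriv _
  have h' := h j ((X ^ 2 - X) ^ j)
  simp only [eval_pow, eval_sub, eval_X] at h'
  simp [Leg, legPoly, h']

theorem degree_legPoly (j : ℕ) : (legPoly j).degree = j := by
  have hc : Real.sqrt (2 * j + 1) / j.factorial ≠ 0 := by positivity
  rw [legPoly, degree_C_mul hc]
  refine le_antisymm ?_ (le_degree_of_ne_zero ?_)
  · refine degree_le_of_natDegree_le ((natDegree_iterate_derivative _ _).trans ?_)
    rw [natDegree_X_sq_sub_X_pow]; omega
  · have := (monic_X_sq_sub_X_pow j).coeff_natDegree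
    rw [natDegree_X_sq_sub_X_pow] at this
    rw [coeff_iterate_derivative, ← two_mul, this]
    have : (2 * j).descFactorial j ≠ 0 := by
      rw [Ne, Nat.descFactorial_eq_zero_iff_lt]; omega
    simpa using this

theorem unitIntegral_legPoly_mul_self (j : ℕ) : unitIntegral (legPoly j * legPoly j) = 1 := by
  have e : legPoly j * legPoly j = C ((2 * j + 1) / (j.factorial : ℝ) ^ 2) *
      (derivative^[j] ((X ^ 2 - X) ^ j) * derivative^[j] ((X ^ 2 - X) ^ j)) := by
    rw [legPoly, mul_mul_mul_comm, ← C_mul, div_mul_div_comm,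
      Real.mul_self_sqrt (by positivity), ← sq]
  have hd : derivative^[j] (derivative^[j] ((X ^ 2 - X : ℝ[X]) ^ j)) =
      C ((2 * j).factorial : ℝ) := by
    rw [← Function.iterate_add_apply, ← two_mul]
    rw [eq_C_of_natDegree_le_zero ((natDegree_iterate_derivative _ _).trans
      (by rw [natDegree_X_sq_sub_X_pow]; omega))]
    have := (monic_X_sq_sub_X_pow j).coeff_natDegree
    rw [natDegree_X_sq_sub_X_pow] at this
    rw [coeff_iterate_derivative, zero_add, this, Nat.descFactorial_self]
    simp
  have hw : (X ^ 2 - X : ℝ[X]) ^ j = C ((-1) ^ j) * (X ^ j * (1 - X) ^ j) := by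
    rw [← mul_pow, C_pow, ← mul_pow]
    congr 1
    simp
    ring
  rw [e, unitIntegral_C_mul, unitIntegral_iterate_derivative_mul j le_rfl, hd, mul_comm _ (C _),
    unitIntegral_C_mul, hw, unitIntegral_C_mul, unitIntegral_X_pow_mul_one_sub_X_pow]
  rw [← two_mul, Nat.factorial_succ]
  have hs : ((-1 : ℝ) ^ j) * (-1) ^ j = 1 := by rw [← mul_pow]; simp
  have := Nat.factorial_ne_zero j
  have := Nat.factorial_ne_zero (2 * j)
  push_cast
  field_simp
  rw [sq, hs]

theorem unitIntegral_legPoly_mul_of_lt {i j : ℕ} (h : i < j) :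
    unitIntegral (legPoly j * legPoly i) = 0 := by
  have hd : derivative^[j] (legPoly i) = 0 :=
    iterate_derivative_eq_zero ((natDegree_eq_of_degree_eq_some (degree_legPoly i)).trans_lt h)
  rw [legPoly, mul_assoc, unitIntegral_C_mul, unitIntegral_iterate_derivative_mul j le_rfl, hd]
  simp [unitIntegral]

theorem unitIntegral_legPoly_mul (i j : ℕ) :
    unitIntegral (legPoly i * legPoly j) = if i = j then 1 else 0 := by
  split_ifs with h
  · rw [h, unitIntegral_legPoly_mul_self]
  · rcases Nat.lt_or_gt_of_ne h with h | h
    · rw [mul_comm, unitIntegral_legPoly_mul_of_lt h]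
    · exact unitIntegral_legPoly_mul_of_lt h

theorem span_range_legPoly : Submodule.span ℝ (range legPoly) = ⊤ :=
  Polynomial.Sequence.span ⟨legPoly, degree_legPoly⟩ fun i =>
    (leadingCoeff_ne_zero.2 (Polynomial.Sequence.ne_zero ⟨legPoly, degree_legPoly⟩ i)).isUnit

end Polynomial

section Hilbert

variable {H : Type*} [NormedAddCommGroup H] [InnerProductSpace ℝ H]

theorem Orthonormal.ofReal_inner_sq_le_of_mem_closure_span {e : ℕ → H} (he : Orthonormal ℝ e)
    {z : H} (hz : z ∈ closure (Submodule.span ℝ (range e) : Set H)) (w : H) :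
    ENNReal.ofReal (inner ℝ z w ^ 2) ≤
      ENNReal.ofReal (‖z‖ ^ 2) * ∑' j, ENNReal.ofReal (inner ℝ (e j) w ^ 2) := by
  have hs : Summable fun j => inner ℝ (e j) w ^ 2 := by
    simpa using he.inner_products_summable (x := w)
  rw [← ENNReal.ofReal_tsum_of_nonneg (fun _ => sq_nonneg _) hs,
    ← ENNReal.ofReal_mul (sq_nonneg _)]
  refine ENNReal.ofReal_le_ofReal ?_
  have hc : IsClosed {z : H | inner ℝ z w ^ 2 ≤ ‖z‖ ^ 2 * ∑' j, inner ℝ (e j) w ^ 2} :=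
    isClosed_le (by fun_prop) (by fun_prop)
  refine closure_minimal ?_ hc hz
  intro y hy
  obtain ⟨c, rfl⟩ := (Finsupp.mem_span_range_iff_exists_finsupp).1 hy
  simp only [mem_ofPred_eq, Finsupp.sum]
  have hn : ‖∑ i ∈ c.support, c i • e i‖ ^ 2 = ∑ i ∈ c.support, c i ^ 2 := by
    rw [← real_inner_self_eq_norm_sq, he.inner_sum]
    simp [sq]
  rw [hn, sum_inner]
  simp only [inner_smul_left, RCLike.conj_to_real]
  refine (Finset.sum_mul_sq_le_sq_mul_sq _ _ _).trans ?_
  gcongr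
  exact hs.sum_le_tsum _ fun _ _ => sq_nonneg _

end Hilbert

section ProbabilityIntegralTransform

variable {Ω : Type*} [MeasurableSpace Ω] {P : Measure Ω} [IsProbabilityMeasure P] {X : Ω → ℝ}

theorem monotone_distFun (P : Measure Ω) [IsProbabilityMeasure P] (X : Ω → ℝ) :
    Monotone (distFun P X) := fun _ _ h =>
  ENNReal.toReal_mono (measure_ne_top _ _) (measure_mono (preimage_mono (Iic_subset_Iic.2 h)))

theorem distFun_eq_cdf (hX : Measurable X) : distFun P X = ProbabilityTheory.cdf (P.map X) := by
  have := Measure.isProbabilityMeasure_map (μ := P) hX.aemeasurable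
  ext x
  rw [ProbabilityTheory.cdf_eq_real, Measure.real, Measure.map_apply hX measurableSet_Iic, distFun]

theorem measure_distFun_comp_le (hX : Measurable X) (hF : Continuous (distFun P X)) {c : ℝ}
    (h0 : 0 < c) (h1 : c < 1) :
    P {ω | distFun P X (X ω) ≤ c} = ENNReal.ofReal c := by
  have hbot : Filter.Tendsto (distFun P X) Filter.atBot (nhds 0) := by
    rw [distFun_eq_cdf hX]; exact ProbabilityTheory.tendsto_cdf_atBot _
  have htop : Filter.Tendsto (distFun P X) Filter.atTop (nhds 1) := by
    rw [distFun_eq_cdf hX]; exact ProbabilityTheory.tendsto_cdf_atTop _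
  obtain ⟨a, ha⟩ := (hbot.eventually_lt_const h0).exists
  obtain ⟨b, hb⟩ := (htop.eventually_const_lt h1).exists
  obtain ⟨x, hx⟩ := mem_range_of_exists_le_of_exists_ge hF ⟨a, ha.le⟩ ⟨b, hb.le⟩
  set S := {y | distFun P X y ≤ c} with hS
  have hSb : BddAbove S := ⟨b, fun y hy => by
    by_contra! h
    exact absurd (monotone_distFun P X h.le) (by simp only [hS, mem_ofPred_eq] at hy; linarith)⟩
  have hm : sSup S ∈ S :=
    (isClosed_le hF continuous_const).csSup_mem ⟨x, hx.le⟩ hSb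
  have hxs : x ≤ sSup S := le_csSup hSb hx.le
  have hv : distFun P X (sSup S) = c := le_antisymm hm (hx ▸ monotone_distFun P X hxs)
  have hset : {ω | distFun P X (X ω) ≤ c} = X ⁻¹' Iic (sSup S) := by
    ext ω
    exact ⟨fun h => le_csSup hSb h, fun h => (monotone_distFun P X h).trans hm⟩
  rw [hset, ← hv, distFun, ENNReal.ofReal_toReal (measure_ne_top _ _)]

/-- The probability integral transform. -/
theorem measurePreserving_distFun_comp (hX : Measurable X) (hF : Continuous (distFun P X)) :
    MeasurePreserving (fun ω => distFun P X (X ω)) P (volume.restrict (Icc 0 1)) := by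
  have hm : Measurable fun ω => distFun P X (X ω) := hF.measurable.comp hX
  refine ⟨hm, ?_⟩
  have := Measure.isProbabilityMeasure_map (μ := P) hm.aemeasurable
  refine Measure.ext_of_Iic _ _ fun c => ?_
  rw [Measure.map_apply hm measurableSet_Iic, Measure.restrict_apply measurableSet_Iic]
  change P {ω | distFun P X (X ω) ≤ c} = _
  rcases le_or_gt 1 c with h1 | h1
  · have e1 : {ω | distFun P X (X ω) ≤ c} = univ :=
      eq_univ_of_forall fun ω => show distFun P X (X ω) ≤ c from
        (ENNReal.toReal_mono ENNReal.one_ne_top prob_le_one).trans (by simpa)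
    have e2 : Iic c ∩ Icc 0 1 = Icc (0 : ℝ) 1 :=
      inter_eq_right.2 fun y hy => hy.2.trans h1
    simp [e1, e2]
  rcases lt_or_ge 0 c with h0 | h0
  · have e2 : Iic c ∩ Icc 0 1 = Icc (0 : ℝ) c := by
      ext y; simp only [mem_inter_iff, mem_Iic, mem_Icc]; grind
    simp [measure_distFun_comp_le hX hF h0 h1, e2]
  · have e1 : P {ω | distFun P X (X ω) ≤ c} = 0 := by
      refine le_antisymm (ENNReal.le_of_forall_pos_le_add fun ε hε _ => ?_) bot_le
      have hm0 : (0 : ℝ) < min (ε : ℝ) (1 / 2) := lt_min hε (by norm_num)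
      have hle : P {ω | distFun P X (X ω) ≤ c} ≤ ENNReal.ofReal (min (ε : ℝ) (1 / 2)) := by
        rw [← measure_distFun_comp_le hX hF hm0 ((min_le_right _ _).trans_lt (by norm_num))]
        exact measure_mono fun ω (h : _ ≤ c) => h.trans (h0.trans hm0.le)
      rw [zero_add]
      refine hle.trans ((ENNReal.ofReal_le_ofReal (min_le_left _ _)).trans ?_)
      simp
    have e2 : volume (Iic c ∩ Icc (0 : ℝ) 1) = 0 := by
      refine measure_mono_null (t := {0}) (fun y hy => ?_) (by simp)
      exact le_antisymm (hy.1.trans h0) hy.2.1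
    rw [e1, e2]

theorem exists_measurable_comp_distFun_ae_eq (hX : Measurable X)
    (hF : Continuous (distFun P X)) :
    ∃ g : ℝ → ℝ, Measurable g ∧ ∀ᵐ ω ∂P, g (distFun P X (X ω)) = X ω := by
  set F := distFun P X
  have hmono : Monotone F := monotone_distFun P X
  let Q : ℝ → EReal := fun u => ⨆ q : ℝ, ⨆ _ : F q < u, (q : EReal)
  have hQ : Monotone Q := fun u v h =>
    iSup_mono fun q => iSup_mono' fun hq => ⟨hq.trans_le h, le_rfl⟩
  refine ⟨fun u => (Q u).toReal, hQ.measurable.ereal_toReal, ?_⟩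
  have hmp := measurePreserving_distFun_comp hX hF
  have hne : ∀ᵐ ω ∂P, ∀ q : ℚ, F (X ω) ≠ F q := by
    rw [ae_all_iff]
    intro q
    refine hmp.quasiMeasurePreserving.ae (p := fun u => u ≠ F q) ?_
    exact Measure.ae_ne _ _
  filter_upwards [hne] with ω hω
  have h : Q (F (X ω)) = (X ω : EReal) := by
    refine le_antisymm (iSup₂_le fun q hq => ?_) ?_
    · exact EReal.coe_le_coe_iff.2 (le_of_lt (hmono.reflect_lt hq))
    · refine le_of_not_gt fun hlt => ?_
      obtain ⟨q, hq1, hq2⟩ := EReal.lt_iff_exists_rat_btwn.1 hlt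
      have hq2' : (q : ℝ) < X ω := by exact_mod_cast hq2
      have : F q < F (X ω) := lt_of_le_of_ne (hmono hq2'.le) (hω q).symm
      have h3 : ((q : ℝ) : EReal) ≤ Q (F (X ω)) :=
        le_iSup₂ (f := fun (q : ℝ) (_ : F q < F (X ω)) => (q : EReal)) (q : ℝ) this
      exact absurd h3 (not_le.2 hq1)
  simp [h]

end ProbabilityIntegralTransform

section Density

open Polynomial

theorem memLp_eval_restrict_Icc (p : ℝ[X]) :
    MemLp (fun x => p.eval x) 2 (volume.restrict (Icc (0 : ℝ) 1)) := by
  obtain ⟨C, hC⟩ := isCompact_Icc.exists_bound_of_continuousOn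
    (p.continuous.continuousOn (s := Icc (0 : ℝ) 1))
  exact MemLp.of_bound p.continuous.aestronglyMeasurable C
    (ae_restrict_of_forall_mem measurableSet_Icc hC)

/-- The `L²([0,1])` class of a polynomial. -/
noncomputable def polyToLp : ℝ[X] →ₗ[ℝ] Lp ℝ 2 (volume.restrict (Icc (0 : ℝ) 1)) where
  toFun p := (memLp_eval_restrict_Icc p).toLp _
  map_add' p q := by
    simp only [eval_add]
    exact MemLp.toLp_add (memLp_eval_restrict_Icc p) (memLp_eval_restrict_Icc q)
  map_smul' c p := by
    simp only [eval_smul]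
    exact MemLp.toLp_const_smul c (memLp_eval_restrict_Icc p)

theorem denseRange_polyToLp : DenseRange polyToLp := by
  have hd := BoundedContinuousFunction.toLp_denseRange (E := ℝ) (p := 2) ℝ
    (μ := volume.restrict (Icc (0 : ℝ) 1)) (by simp)
  refine dense_closure.1 (hd.mono ?_)
  rintro _ ⟨g, rfl⟩
  refine Metric.mem_closure_iff.2 fun ε hε => ?_
  obtain ⟨p, hp⟩ := exists_polynomial_near_of_continuousOn 0 1 g g.continuous.continuousOn
    (ε / 2) (half_pos hε)
  refine ⟨_, ⟨p, rfl⟩, ?_⟩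
  rw [dist_eq_norm]
  refine (Lp.norm_le_of_ae_bound (half_pos hε).le ?_).trans_lt (?_ : _ < ε)
  · filter_upwards [Lp.coeFn_sub (BoundedContinuousFunction.toLp 2
      (volume.restrict (Icc (0 : ℝ) 1)) ℝ g) (polyToLp p),
      BoundedContinuousFunction.coeFn_toLp (p := 2) (𝕜 := ℝ)
        (volume.restrict (Icc (0 : ℝ) 1)) g,
      (memLp_eval_restrict_Icc p).coeFn_toLp, ae_restrict_mem measurableSet_Icc]
      with x h1 h2 h3 hx
    have h3' : polyToLp p x = p.eval x := h3
    rw [h1, Pi.sub_apply, h2, h3', norm_sub_rev]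
    exact (hp x hx).le
  · simp [measureUnivNNReal, half_lt_self hε]

theorem inner_toLp_toLp {Ω : Type*} [MeasurableSpace Ω] {P : Measure Ω} {f g : Ω → ℝ}
    (hf : MemLp f 2 P) (hg : MemLp g 2 P) :
    inner ℝ (hf.toLp f) (hg.toLp g) = ∫ ω, f ω * g ω ∂P := by
  rw [L2.inner_def]
  refine integral_congr_ae ?_
  filter_upwards [hf.coeFn_toLp, hg.coeFn_toLp] with ω h1 h2
  rw [h1, h2]
  simp [mul_comm]

theorem orthonormal_polyToLp_legPoly : Orthonormal ℝ (polyToLp ∘ legPoly) := by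
  rw [orthonormal_iff_ite]
  intro i j
  rw [← unitIntegral_legPoly_mul]
  refine (inner_toLp_toLp (memLp_eval_restrict_Icc _) (memLp_eval_restrict_Icc _)).trans ?_
  rw [unitIntegral, intervalIntegral.integral_of_le zero_le_one, integral_Icc_eq_integral_Ioc]
  simp

theorem closure_span_range_polyToLp_legPoly :
    closure (Submodule.span ℝ (range (polyToLp ∘ legPoly)) :
      Set (Lp ℝ 2 (volume.restrict (Icc (0 : ℝ) 1)))) = univ := by
  rw [range_comp, Submodule.span_image, span_range_legPoly, Submodule.map_top]
  exact denseRange_polyToLp.closure_range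

end Density

section LegendreScores

variable {Ω : Type*} [MeasurableSpace Ω] {P : Measure Ω} [IsProbabilityMeasure P] {X : Ω → ℝ}

theorem memLp_Leg_comp (hX : Measurable X) (hF : Continuous (distFun P X)) (j : ℕ) :
    MemLp (fun ω => Leg j (distFun P X (X ω))) 2 P := by
  simp only [Polynomial.Leg_eq_eval_legPoly]
  exact (memLp_eval_restrict_Icc (legPoly j)).comp_measurePreserving
    (measurePreserving_distFun_comp hX hF)

/-- The `L²` class of the score `Leg j (F(X;X))`. -/
noncomputable def legScore (hX : Measurable X) (hF : Continuous (distFun P X)) (j : ℕ) :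
    Lp ℝ 2 P :=
  (memLp_Leg_comp hX hF j).toLp _

theorem legScore_eq (hX : Measurable X) (hF : Continuous (distFun P X)) :
    legScore hX hF = Lp.compMeasurePreservingₗᵢ ℝ _ (measurePreserving_distFun_comp hX hF) ∘
      (polyToLp ∘ legPoly) := by
  ext1 j
  simp only [legScore, Polynomial.Leg_eq_eval_legPoly]
  rfl

theorem orthonormal_legScore (hX : Measurable X) (hF : Continuous (distFun P X)) :
    Orthonormal ℝ (legScore hX hF) := by
  rw [legScore_eq]
  exact orthonormal_polyToLp_legPoly.comp_linearIsometry _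

theorem mem_closure_span_legScore (hX : Measurable X) (hF : Continuous (distFun P X))
    {g : ℝ → ℝ} (hg : Measurable g) {f : Ω → ℝ} (hf : MemLp f 2 P)
    (hfg : ∀ᵐ ω ∂P, g (distFun P X (X ω)) = f ω) :
    hf.toLp f ∈ closure (Submodule.span ℝ (range (legScore hX hF)) : Set (Lp ℝ 2 P)) := by
  have hmp := measurePreserving_distFun_comp hX hF
  have hg2 : MemLp g 2 (volume.restrict (Icc (0 : ℝ) 1)) := by
    rw [← hmp.map_eq, memLp_map_measure_iff hg.aestronglyMeasurable hmp.aemeasurable]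
    exact (memLp_congr_ae hfg).2 hf
  have he : hf.toLp f = Lp.compMeasurePreservingₗᵢ ℝ _ hmp (hg2.toLp g) := by
    refine Eq.trans ?_ (Lp.toLp_compMeasurePreserving hg2 hmp).symm
    rw [MemLp.toLp_eq_toLp_iff]
    filter_upwards [hfg] with ω h using h.symm
  rw [legScore_eq, range_comp, ← LinearIsometry.coe_toLinearMap, Submodule.span_image, he]
  refine map_mem_closure (LinearIsometry.continuous _)
    (closure_span_range_polyToLp_legPoly ▸ mem_univ (hg2.toLp g)) fun y hy => ?_
  exact Submodule.mem_map_of_mem hy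

theorem memLp_stdize (hX2 : MemLp X 2 P) : MemLp (stdize P X) 2 P := by
  change MemLp (fun ω => (X ω - ∫ ω', X ω' ∂P) / Real.sqrt (ProbabilityTheory.variance X P)) 2 P
  simp only [div_eq_mul_inv]
  exact (hX2.sub (memLp_const _)).mul_const _

theorem integral_stdize (hX2 : MemLp X 2 P) : ∫ ω, stdize P X ω ∂P = 0 := by
  simp only [stdize]
  rw [integral_div, integral_sub (hX2.integrable (by simp)) (integrable_const _)]
  simp

theorem norm_toLp_stdize_sq (hX2 : MemLp X 2 P) (hv : 0 < ProbabilityTheory.variance X P) :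
    ‖(memLp_stdize hX2).toLp (stdize P X)‖ ^ 2 = 1 := by
  rw [← real_inner_self_eq_norm_sq, inner_toLp_toLp]
  simp only [stdize, ← sq, div_pow, Real.sq_sqrt hv.le]
  rw [integral_div, ← ProbabilityTheory.variance_eq_integral hX2.aestronglyMeasurable.aemeasurable,
    div_self hv.ne']

theorem toLp_stdize_mem_closure_span_legScore (hX : Measurable X)
    (hF : Continuous (distFun P X)) (hX2 : MemLp X 2 P) :
    (memLp_stdize hX2).toLp (stdize P X) ∈
      closure (Submodule.span ℝ (range (legScore hX hF)) : Set (Lp ℝ 2 P)) := by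
  obtain ⟨g, hg, hgX⟩ := exists_measurable_comp_distFun_ae_eq hX hF
  refine mem_closure_span_legScore hX hF
    (g := fun u => (g u - ∫ ω, X ω ∂P) / Real.sqrt (ProbabilityTheory.variance X P))
    (by fun_prop) _ ?_
  filter_upwards [hgX] with ω h
  rw [h, stdize]

theorem Leg_zero (u : ℝ) : Leg 0 u = 1 := by simp [Leg]

theorem integral_Leg_comp (hX : Measurable X) (hF : Continuous (distFun P X)) (j : ℕ) :
    ∫ ω, Leg (j + 1) (distFun P X (X ω)) ∂P = 0 := by
  have h : inner ℝ (legScore hX hF (j + 1)) (legScore hX hF 0) = 0 :=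
    (orthonormal_legScore hX hF).2 (Nat.succ_ne_zero j)
  rw [legScore, legScore, inner_toLp_toLp] at h
  simpa [Leg_zero] using h

end LegendreScores

theorem ENNReal.tsum_eq_tsum_succ {f : ℕ → ENNReal} (h : f 0 = 0) :
    ∑' n, f n = ∑' n, f (n + 1) := by
  rw [tsum_eq_zero_add' ENNReal.summable, h, zero_add]

/-- The squared Pearson correlation is bounded by the LPINFOR
dependence measure: `R(X,Y)² ≤ ∑_{j,k≥1} |LP(j,k;X,Y)|²`, the (possibly
infinite) double sum being taken in `[0,∞]`. -/
theorem pearson_sq_le_LPINFOR {Ω : Type*} [MeasurableSpace Ω]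
    (P : Measure Ω) [IsProbabilityMeasure P] (X Y : Ω → ℝ)
    (hX : Measurable X) (hY : Measurable Y)
    (hX2 : MemLp X 2 P) (hY2 : MemLp Y 2 P)
    (hvX : 0 < ProbabilityTheory.variance X P)
    (hvY : 0 < ProbabilityTheory.variance Y P)
    (hFX : Continuous (distFun P X)) (hFY : Continuous (distFun P Y)) :
    ENNReal.ofReal ((∫ ω, stdize P X ω * stdize P Y ω ∂P) ^ 2)
      ≤ ∑' (j : ℕ) (k : ℕ), ENNReal.ofReal (|LPcom P X Y (j + 1) (k + 1)| ^ 2) := by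
  rw [← inner_toLp_toLp (memLp_stdize hX2) (memLp_stdize hY2)]
  refine ((orthonormal_legScore hX hFX).ofReal_inner_sq_le_of_mem_closure_span
    (toLp_stdize_mem_closure_span_legScore hX hFX hX2) _).trans ?_
  rw [norm_toLp_stdize_sq hX2 hvX, ENNReal.ofReal_one, one_mul, ENNReal.tsum_eq_tsum_succ]
  · refine ENNReal.tsum_le_tsum fun j => ?_
    rw [real_inner_comm]
    refine ((orthonormal_legScore hY hFY).ofReal_inner_sq_le_of_mem_closure_span
      (toLp_stdize_mem_closure_span_legScore hY hFY hY2) _).trans ?_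
    rw [norm_toLp_stdize_sq hY2 hvY, ENNReal.ofReal_one, one_mul, ENNReal.tsum_eq_tsum_succ]
    · refine ENNReal.tsum_le_tsum fun k => le_of_eq ?_
      rw [real_inner_comm, legScore, legScore, inner_toLp_toLp, sq_abs, LPcom]
    · rw [legScore, legScore, inner_toLp_toLp]
      simp [Leg_zero, integral_Leg_comp hX hFX]
  · rw [legScore, inner_toLp_toLp]
    simp [Leg_zero, integral_stdize hY2]
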